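/- arXiv:2503.03082 — 4 statements merged into one kernel-verified Lean document; each statement's English description precedes it below -/
import Mathlib

section
/- Every group-satisfaction-threshold (GST) axiom is a linear mapping: for every threshold function τ : C_k × 2^ℰ → {0,1,…,k+1} there exist K ∈ ℕ, vectors h_1,…,h_K ∈ ℝ^{|ℰ|}, and a function g : {+,−,0}^K → 2^{C_k} such that for every profile P over ℰ, GST_τ(P) = g(sign(Hist(P)·h_1),…,sign(Hist(P)·h_K)). -/
/-- The histogram of a profile dotted with a hyperplane vector. -/
noncomputable def histDot {E : Type*} [Fintype E] [DecidableEq E]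
    (P : List E) (h : E → ℝ) : ℝ :=
  ∑ e, (P.count e : ℝ) * h e

/-- A mapping from profiles to a decision space `D` is linear if it factors through
the signs of finitely many hyperplanes applied to the histogram of the profile. -/
def IsLinearMapping {E : Type*} [Fintype E] [DecidableEq E] {D : Type*}
    (f : List E → D) : Prop :=
  ∃ (K : ℕ) (h : Fin K → E → ℝ) (g : (Fin K → SignType) → D),
    ∀ P : List E, f P = g fun j => SignType.sign (histDot P (h j))

/-- Number of agents in `P` whose preference lies in the family `G`. -/
def countIn {E : Type*} [DecidableEq E] (P : List E) (G : Finset E) : ℕ :=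
  P.countP fun e => decide (e ∈ G)

/-- The GST axiom with threshold function `τ`: it maps a profile `P` of `n`
preferences to the set of `k`-committees `W` such that for every `G ⊆ ℰ`, the number
of agents with preference in `G` is strictly less than `τ(W,G)·n/k`. -/
def gstMap {E : Type*} [DecidableEq E] (m k : ℕ)
    (τ : Finset (Fin m) → Finset E → ℕ) (P : List E) : Set (Finset (Fin m)) :=
  {W | W.card = k ∧ ∀ G : Finset E, countIn P G * k < τ W G * P.length}

theorem histDot_eq_sum_map {E : Type*} [Fintype E] [DecidableEq E] (P : List E) (h : E → ℝ) :
    histDot P h = (P.map h).sum := by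
  rw [Finset.sum_list_map_count, histDot]
  simp only [nsmul_eq_mul]
  refine (Finset.sum_subset (Finset.subset_univ _) fun e _ he => ?_).symm
  rw [List.count_eq_zero_of_not_mem (by simpa using he), Nat.cast_zero, zero_mul]

theorem sum_map_indicator_sub {E : Type*} [DecidableEq E] (P : List E) (G : Finset E)
    (a b : ℝ) :
    (P.map fun e => (if e ∈ G then a else 0) - b).sum = countIn P G * a - b * P.length := by
  induction P with
  | nil => simp [countIn]
  | cons e P ih =>
    rw [List.map_cons, List.sum_cons, ih]
    by_cases he : e ∈ G <;> simp [countIn, he] <;> ring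

/-- A mapping that factors through hyperplane signs indexed by any finite type is linear. -/
theorem IsLinearMapping.of_fintype {E D ι : Type*} [Fintype E] [DecidableEq E] [Fintype ι]
    {f : List E → D} (h : ι → E → ℝ) (g : (ι → SignType) → D)
    (hf : ∀ P, f P = g fun i => SignType.sign (histDot P (h i))) : IsLinearMapping f :=
  ⟨Fintype.card ι, fun j => h ((Fintype.equivFin ι).symm j),
    fun s => g fun i => s (Fintype.equivFin ι i), fun P => by simp [hf P]⟩

/-- every group-satisfaction-threshold axiom is a linear mapping. -/
theorem gst_isLinear (E : Type*) [Fintype E] [DecidableEq E] (m k : ℕ)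
    (hk : 1 ≤ k) (hkm : k ≤ m)
    (τ : Finset (Fin m) → Finset E → ℕ) (hτ : ∀ W G, τ W G ≤ k + 1) :
    IsLinearMapping (gstMap m k τ) := by
  refine .of_fintype (ι := Finset (Fin m) × Finset E)
    (fun i e => (if e ∈ i.2 then (k : ℝ) else 0) - τ i.1 i.2)
    (fun s => {W | W.card = k ∧ ∀ G, s (W, G) = -1}) fun P => ?_
  ext W
  simp only [gstMap, Set.mem_ofPred_eq, histDot_eq_sum_map, sum_map_indicator_sub,
    sign_eq_neg_one_iff, sub_neg]
  norm_cast
end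

section
/- Let ℰ be a finite preference space with |ℰ| ≥ 2 and let 1 ≤ k ≤ m. Let ℱ_GST denote the set of all GST axioms over ℰ, i.e., all mappings GST_τ for threshold functions τ : C_k × 2^ℰ → {0,1,…,k+1}. Then √(2/π)·2^{|ℰ|}/|ℰ| ≤ Ndim(ℱ_GST) ≤ 2^{|ℰ|}·C(m,k)·log₂(k+2). -/
/-- A set `S` of profiles is (Natarajan-)shattered by a family `F` of functions:
there are witnesses `f0 f1` disagreeing on every element of `S` such that every
dichotomy of `S` is realized by some member of `F`. -/
def Shatters {P : Type*} {D : Type*} (F : Set (P → D)) (S : Finset P) : Prop :=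
  ∃ f0 f1 : P → D,
    (∀ x ∈ S, f0 x ≠ f1 x) ∧
    ∀ B ⊆ S, ∃ f ∈ F, (∀ x ∈ B, f x = f0 x) ∧ ∀ x ∈ S, x ∉ B → f x = f1 x

/-- The family of all GST axioms over `E`. -/
def GSTFamily (E : Type*) [DecidableEq E] (m k : ℕ) :
    Set (List E → Set (Finset (Fin m))) :=
  {f | ∃ τ : Finset (Fin m) → Finset E → ℕ,
    (∀ W G, τ W G ≤ k + 1) ∧ f = gstMap m k τ}

/-- The GST map only depends on the thresholds of the committees of size `k`. -/
theorem gstMap_congr {E : Type*} [DecidableEq E] {m k : ℕ}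
    {τ τ' : Finset (Fin m) → Finset E → ℕ}
    (h : ∀ W : Finset (Fin m), W.card = k → ∀ G, τ W G = τ' W G) :
    gstMap m k τ = gstMap m k τ' := by
  funext P
  ext W
  simp only [gstMap, Set.mem_ofPred_eq]
  refine and_congr_right fun hW => forall_congr' fun G => ?_
  rw [h W hW G]

/-- A set shattered by a family parametrized by a finite type `T` has at most
`log₂ |T|` elements. -/
theorem Shatters.two_pow_card_le {P D T : Type*} [Fintype T] {F : Set (P → D)}
    {S : Finset P} (hS : Shatters F S) (code : (P → D) → T)
    (hcode : Set.InjOn code F) : 2 ^ S.card ≤ Fintype.card T := by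
  obtain ⟨f0, f1, hne, h⟩ := hS
  have : Nonempty (P → D) := ⟨f0⟩
  choose! f hfF hf0 hf1 using h
  have hsub : ∀ B ⊆ S, ∀ B' ⊆ S, f B = f B' → B ⊆ B' := by
    intro B hB B' hB' hff x hx
    by_contra hx'
    exact hne x (hB hx) ((hf0 B hB x hx).symm.trans
      ((congrFun hff x).trans (hf1 B' hB' x (hB hx) hx')))
  rw [← Finset.card_powerset, ← Finset.card_univ]
  refine Finset.card_le_card_of_injOn (fun B => code (f B)) (by simp) ?_
  intro B hB B' hB' hBB
  have hB := Finset.mem_powerset.1 (Finset.mem_coe.1 hB)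
  have hB' := Finset.mem_powerset.1 (Finset.mem_coe.1 hB')
  have hff : f B = f B' := hcode (hfF B hB) (hfF B' hB') hBB
  exact (hsub B hB B' hB' hff).antisymm (hsub B' hB' B hB hff.symm)

/-- There are at most `(k+2)^(C(m,k)·2^|E|)` GST axioms, and this limits shattered sets. -/
theorem two_pow_card_le_of_shatters_GSTFamily {E : Type*} [Fintype E] [DecidableEq E]
    {m k : ℕ} {S : Finset (List E)} (hS : Shatters (GSTFamily E m k) S) :
    2 ^ S.card ≤ (k + 2) ^ (m.choose k * 2 ^ Fintype.card E) := by
  classical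
  have h : ∀ f ∈ GSTFamily E m k, ∃ τ : Finset (Fin m) → Finset E → ℕ,
    (∀ W G, τ W G ≤ k + 1) ∧ f = gstMap m k τ := fun _ hf => hf
  choose! τ hτ hfτ using h
  let code : (List E → Set (Finset (Fin m))) →
      ({W : Finset (Fin m) // W.card = k} × Finset E → Fin (k + 2)) :=
    fun f p => Fin.ofNat (k + 2) (τ f p.1 p.2)
  refine (hS.two_pow_card_le code ?_).trans_eq ?_
  · intro f hf g hg hfg
    rw [hfτ f hf, hfτ g hg]
    refine gstMap_congr fun W hW G => ?_
    have := congrArg Fin.val (congrFun hfg (⟨W, hW⟩, G))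
    simpa [code, Fin.ofNat, Nat.mod_eq_of_lt (Nat.lt_succ_of_le (hτ f hf W G)),
      Nat.mod_eq_of_lt (Nat.lt_succ_of_le (hτ g hg W G))] using this
  · simp

theorem countIn_le_length {E : Type*} [DecidableEq E] (P : List E) (G : Finset E) :
    countIn P G ≤ P.length :=
  List.countP_le_length

theorem countIn_eq_length_iff {E : Type*} [DecidableEq E] {P : List E} {G : Finset E} :
    countIn P G = P.length ↔ ∀ e ∈ P, e ∈ G := by
  simp [countIn, List.countP_eq_length]

/-- The profiles consisting of one agent per element of a nonempty `A`, for `A` ranging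
over an antichain, are shattered by the GST axioms. -/
theorem shatters_GSTFamily_of_antichain {E : Type*} [DecidableEq E] {m k : ℕ}
    (hk : 1 ≤ k) (hkm : k ≤ m) {𝒜 : Finset (Finset E)}
    (hanti : IsAntichain (· ⊆ ·) (𝒜 : Set (Finset E))) (hne : ∀ A ∈ 𝒜, A.Nonempty) :
    Shatters (GSTFamily E m k) (𝒜.image Finset.toList) := by
  refine ⟨fun _ => {W | W.card = k}, fun _ => ∅, fun _ _ => ?_, fun B hB => ?_⟩
  · obtain ⟨W, -, hW⟩ := Finset.exists_subset_card_eq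
      (show k ≤ (Finset.univ : Finset (Fin m)).card by simpa using hkm)
    exact Set.Nonempty.ne_empty ⟨W, hW⟩
  · refine ⟨_, ⟨fun _ G => if G ∈ 𝒜 ∧ G.toList ∉ B then k else k + 1, ?_, rfl⟩, ?_, ?_⟩
    · intro W G
      dsimp only
      split_ifs <;> omega
    · intro x hx
      obtain ⟨A, hA, rfl⟩ := Finset.mem_image.1 (hB hx)
      ext W
      simp only [gstMap, Set.mem_ofPred_eq, and_iff_left_iff_imp]
      intro _ G
      have hpos : 0 < A.toList.length := by simpa using (hne A hA).card_pos
      have hle := countIn_le_length A.toList G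
      split_ifs with hG
      · have hlt : countIn A.toList G < A.toList.length := by
          refine hle.lt_of_ne fun h => hG.2 ?_
          have hAG : A ⊆ G := fun e he =>
            countIn_eq_length_iff.1 h e (Finset.mem_toList.2 he)
          rwa [← hanti.eq hA hG.1 hAG]
        rw [mul_comm]
        exact Nat.mul_lt_mul_of_pos_left hlt hk
      · nlinarith
    · intro x hx hxB
      obtain ⟨A, hA, rfl⟩ := Finset.mem_image.1 hx
      rw [Set.eq_empty_iff_forall_notMem]
      rintro W ⟨-, hW⟩
      have h := hW A
      dsimp only at h
      rw [if_pos ⟨hA, hxB⟩, countIn_eq_length_iff.2 fun e he => Finset.mem_toList.1 he,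
        mul_comm] at h
      exact h.false

theorem two_pow_le_mul_choose_half {n : ℕ} (hn : 2 ≤ n) :
    2 ^ n ≤ n * n.choose (n / 2) := by
  obtain ⟨p, rfl⟩ : ∃ p, n = p + 2 := ⟨n - 2, by omega⟩
  have hmid : 2 ≤ (p + 2).choose ((p + 2) / 2) := by
    have := Nat.choose_le_middle 1 (p + 2)
    rw [Nat.choose_one_right] at this
    omega
  have hsum : ∑ i ∈ Finset.range (p + 1), (p + 2).choose (i + 1) ≤
      (p + 1) * (p + 2).choose ((p + 2) / 2) := by
    simpa using Finset.sum_le_card_nsmul (Finset.range (p + 1)) _ _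
      fun i _ => Nat.choose_le_middle (i + 1) (p + 2)
  rw [← Nat.sum_range_choose (p + 2), Finset.sum_range_succ, Finset.sum_range_succ']
  simp only [Nat.choose_zero_right, Nat.choose_self]
  linarith

/-- bounds on the Natarajan dimension of the family of GST axioms:
`√(2/π)·2^{|ℰ|}/|ℰ| ≤ Ndim(ℱ_GST) ≤ 2^{|ℰ|}·C(m,k)·log₂(k+2)`. -/
theorem ndim_gst (E : Type*) [Fintype E] [DecidableEq E] (m k : ℕ)
    (hE : 2 ≤ Fintype.card E) (hk : 1 ≤ k) (hkm : k ≤ m) :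
    (∃ S : Finset (List E), Shatters (GSTFamily E m k) S ∧
      Real.sqrt (2 / Real.pi) * 2 ^ Fintype.card E / (Fintype.card E : ℝ)
        ≤ (S.card : ℝ)) ∧
    ∀ S : Finset (List E), Shatters (GSTFamily E m k) S →
      (S.card : ℝ) ≤ 2 ^ Fintype.card E * (m.choose k : ℝ) *
        Real.logb 2 ((k : ℝ) + 2) := by
  constructor
  · set n := Fintype.card E with hn
    refine ⟨(Finset.powersetCard (n / 2) Finset.univ).image Finset.toList,
      shatters_GSTFamily_of_antichain hk hkm ?_ ?_, ?_⟩
    · intro A hA B hB hAB hsub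
      have hA := (Finset.mem_powersetCard.1 (Finset.mem_coe.1 hA)).2
      have hB := (Finset.mem_powersetCard.1 (Finset.mem_coe.1 hB)).2
      exact hAB (Finset.eq_of_subset_of_card_le hsub (by omega))
    · intro A hA
      rw [← Finset.card_pos, (Finset.mem_powersetCard.1 hA).2]
      omega
    · have hinj : Function.Injective (Finset.toList : Finset E → List E) := fun A B h => by
        rw [← Finset.toList_toFinset A, h, Finset.toList_toFinset]
      rw [Finset.card_image_of_injective _ hinj, Finset.card_powersetCard, Finset.card_univ,
        ← hn, div_le_iff₀ (by positivity)]
      have hsqrt : Real.sqrt (2 / Real.pi) ≤ 1 := by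
        rw [Real.sqrt_le_iff, one_pow, div_le_one Real.pi_pos]
        exact ⟨zero_le_one, Real.two_le_pi⟩
      have hpow : (2 : ℝ) ^ n ≤ n * n.choose (n / 2) := by
        exact_mod_cast two_pow_le_mul_choose_half hE
      calc Real.sqrt (2 / Real.pi) * 2 ^ n ≤ 1 * 2 ^ n := by gcongr
        _ ≤ n.choose (n / 2) * n := by linarith
  · intro S hS
    have h : (2 : ℝ) ^ S.card ≤ ((k : ℝ) + 2) ^ (m.choose k * 2 ^ Fintype.card E) := by
      exact_mod_cast two_pow_card_le_of_shatters_GSTFamily hS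
    have hlog := Real.logb_le_logb_of_le one_lt_two (by positivity) h
    rw [Real.logb_pow, Real.logb_pow, Real.logb_self_eq_one one_lt_two, mul_one] at hlog
    push_cast at hlog
    linarith
end

section
/- Let m ≥ 2 and 1 ≤ k ≤ m, and let ℰ = 2^𝒜 where 𝒜 = {1,…,m}. Let ℱ_sGST denote the set of all symmetric GST axioms, i.e., mappings GST_τ whose threshold function τ : C_k × 2^ℰ → {0,1,…,k+1} satisfies τ(W,G) = τ(σ(W),σ(G)) for every permutation σ of 𝒜, every W ∈ C_k, and every G ⊆ ℰ. Then √(2/π)·2^{2^m}/(2^m·m!) ≤ Ndim(ℱ_sGST) ≤ 2^{2^m}·log₂(k+2). -/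
/-- The family of all symmetric GST axioms over the preference space `ℰ = 2^𝒜`:
the threshold function is invariant under permutations of the alternatives. -/
def SymmGSTFamily (m k : ℕ) :
    Set (List (Finset (Fin m)) → Set (Finset (Fin m))) :=
  {f | ∃ τ : Finset (Fin m) → Finset (Finset (Fin m)) → ℕ,
    (∀ W G, τ W G ≤ k + 1) ∧
    (∀ (σ : Equiv.Perm (Fin m)) (W : Finset (Fin m))
        (G : Finset (Finset (Fin m))),
      τ W G = τ (W.image σ) (G.image fun A => A.image σ)) ∧
    f = gstMap m k τ}

/-- An invariant finite set under a finite group contains pairwise inequivalent elements, at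
least as many as its size divided by the order of the group. -/
theorem exists_pairwise_inequivalent {Γ X : Type*} [Group Γ] [Fintype Γ] [MulAction Γ X]
    (s : Finset X) (hs : ∀ (g : Γ), ∀ x ∈ s, g • x ∈ s) :
    ∃ T ⊆ s, (∀ x ∈ T, ∀ y ∈ T, ∀ g : Γ, g • x = y → x = y) ∧
      s.card ≤ Fintype.card Γ * T.card := by
  classical
  let rep : X → X := fun x => (Quotient.mk (MulAction.orbitRel Γ X) x).out
  have hrep (x : X) : ∃ g : Γ, g • x = rep x := Quotient.mk_out (s := MulAction.orbitRel Γ X) x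
  refine ⟨s.image rep, ?_, ?_, ?_⟩
  · intro y hy
    obtain ⟨x, hx, rfl⟩ := Finset.mem_image.mp hy
    obtain ⟨g, hg⟩ := hrep x
    exact hg ▸ hs g x hx
  · intro x hx y hy g hg
    obtain ⟨a, -, rfl⟩ := Finset.mem_image.mp hx
    obtain ⟨b, -, rfl⟩ := Finset.mem_image.mp hy
    obtain ⟨g₁, h₁⟩ := hrep a
    obtain ⟨g₂, h₂⟩ := hrep b
    have hab : Quotient.mk (MulAction.orbitRel Γ X) a = Quotient.mk _ b := by
      refine Quotient.sound ⟨g₁⁻¹ * (g⁻¹ * g₂), ?_⟩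
      change (g₁⁻¹ * (g⁻¹ * g₂)) • b = a
      rw [mul_smul, mul_smul, h₂, ← hg, inv_smul_smul, ← h₁, inv_smul_smul]
    exact congrArg Quotient.out hab
  · refine Finset.card_le_mul_card_image s _ fun b _ => ?_
    have hsub : (s.filter fun a => rep a = b) ⊆ Finset.univ.image fun g : Γ => g • b := by
      intro a ha
      obtain ⟨g, hg⟩ := hrep a
      refine Finset.mem_image.mpr ⟨g⁻¹, Finset.mem_univ _, ?_⟩
      rw [← (Finset.mem_filter.mp ha).2, ← hg, inv_smul_smul]
    exact (Finset.card_le_card hsub).trans Finset.card_image_le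

theorem countIn_toList {E : Type*} [DecidableEq E] (G G' : Finset E) :
    countIn G.toList G' = (G ∩ G').card := by
  rw [countIn, List.countP_eq_length_filter, ← Finset.filter_mem_eq_inter, Finset.card,
    Finset.filter_val, ← Finset.coe_toList G, Multiset.filter_coe, Multiset.coe_card]

open scoped Pointwise in
/-- Unanimous profiles of pairwise inequivalent families of the same size are shattered. -/
theorem shatters_symmGSTFamily {m k n : ℕ} (hk : 1 ≤ k) (hkm : k ≤ m) (hn : 0 < n)
    (T : Finset (Finset (Finset (Fin m)))) (hcard : ∀ G ∈ T, G.card = n)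
    (hT : ∀ G ∈ T, ∀ G' ∈ T, ∀ σ : Equiv.Perm (Fin m), σ • G = G' → G = G') :
    Shatters (SymmGSTFamily m k) (T.image Finset.toList) := by
  classical
  refine ⟨fun _ => ∅, fun _ => {W | W.card = k}, ?_, ?_⟩
  · intro _ _ h
    obtain ⟨W, -, hW⟩ := Finset.exists_subset_card_eq
      (show k ≤ (Finset.univ : Finset (Fin m)).card by simpa using hkm)
    exact Set.notMem_empty W (h.symm.subset hW)
  intro B hB
  let p : Finset (Finset (Fin m)) → Prop := fun G' =>
    ∃ H ∈ T, H.toList ∈ B ∧ ∃ σ : Equiv.Perm (Fin m), σ • H = G'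
  have hp (σ : Equiv.Perm (Fin m)) (G : Finset (Finset (Fin m))) : p G ↔ p (σ • G) := by
    constructor
    · rintro ⟨H, hH, hHB, ρ, rfl⟩
      exact ⟨H, hH, hHB, σ * ρ, mul_smul _ _ _⟩
    · rintro ⟨H, hH, hHB, ρ, hρ⟩
      exact ⟨H, hH, hHB, σ⁻¹ * ρ, by rw [mul_smul, hρ, inv_smul_smul]⟩
  refine ⟨gstMap m k fun _ G => if p G then k else k + 1, ⟨_, ?_, ?_, rfl⟩, ?_, ?_⟩
  · intro _ G
    split_ifs <;> omega
  · intro σ _ G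
    exact if_congr (hp σ G) rfl rfl
  · intro x hx
    obtain ⟨G, hG, rfl⟩ := Finset.mem_image.mp (hB hx)
    refine Set.eq_empty_of_forall_notMem fun W hW => ?_
    have h : countIn G.toList G * k < (if p G then k else k + 1) * G.toList.length := hW.2 G
    have hpG : p G := ⟨G, hG, hx, 1, one_smul _ _⟩
    rw [countIn_toList, Finset.inter_self, Finset.length_toList, if_pos hpG, mul_comm] at h
    exact lt_irrefl _ h
  · intro x hx hxB
    obtain ⟨G, hG, rfl⟩ := Finset.mem_image.mp hx
    ext W
    refine ⟨fun h => h.1, fun hW => ⟨hW, fun G' => ?_⟩⟩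
    change countIn G.toList G' * k < (if p G' then k else k + 1) * G.toList.length
    rw [countIn_toList, Finset.length_toList, hcard G hG]
    have hle : (G ∩ G').card ≤ n := hcard G hG ▸ Finset.card_le_card Finset.inter_subset_left
    split_ifs with hG'
    · obtain ⟨H, hH, hHB, σ, rfl⟩ := hG'
      have hlt : (G ∩ σ • H).card < n := by
        refine lt_of_le_of_ne hle fun h => hxB ?_
        have h₁ : G ∩ σ • H = G :=
          Finset.eq_of_subset_of_card_le Finset.inter_subset_left (by rw [h, hcard G hG])
        have h₂ : G = σ • H := Finset.eq_of_subset_of_card_le (Finset.inter_eq_left.mp h₁)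
          (by rw [Finset.card_smul_finset, hcard G hG, hcard H hH])
        rwa [← hT H hH G hG σ h₂.symm]
      rw [mul_comm k]
      exact Nat.mul_lt_mul_of_pos_right hlt hk
    · nlinarith

open scoped Pointwise in
/-- The symmetric GST axioms shatter a set of profiles of size at least `2 ^ 2 ^ m / (2 ^ m * m!)`. -/
theorem exists_shatters_symmGSTFamily {m k : ℕ} (hm : 1 ≤ m) (hk : 1 ≤ k) (hkm : k ≤ m) :
    ∃ S : Finset (List (Finset (Fin m))), Shatters (SymmGSTFamily m k) S ∧
      2 ^ 2 ^ m ≤ 2 ^ m * m.factorial * S.card := by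
  classical
  obtain ⟨d, rfl⟩ := Nat.exists_eq_add_of_le' hm
  have hn : 0 < 2 ^ d := by positivity
  obtain ⟨T, hTs, hT, hle⟩ := exists_pairwise_inequivalent (Γ := Equiv.Perm (Fin (d + 1)))
    (Finset.powersetCard (2 ^ d) (Finset.univ : Finset (Finset (Fin (d + 1))))) (by
      intro g x hx
      rw [Finset.mem_powersetCard_univ] at hx ⊢
      rw [Finset.card_smul_finset, hx])
  refine ⟨T.image Finset.toList, shatters_symmGSTFamily hk hkm hn T
    (fun G hG => Finset.mem_powersetCard_univ.mp (hTs hG)) hT, ?_⟩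
  have hinj : Function.Injective
      (Finset.toList : Finset (Finset (Fin (d + 1))) → List (Finset (Fin (d + 1)))) :=
    fun G H h => by rw [← Finset.toList_toFinset G, h, Finset.toList_toFinset]
  rw [Finset.card_image_of_injective _ hinj]
  have hcb := Nat.four_pow_le_two_mul_self_mul_centralBinom (2 ^ d) hn
  rw [Finset.card_powersetCard, Finset.card_univ, Fintype.card_finset, Fintype.card_fin,
    Fintype.card_perm, Fintype.card_fin, pow_succ', ← Nat.centralBinom_eq_two_mul_choose] at hle
  calc 2 ^ 2 ^ (d + 1) = 4 ^ 2 ^ d := by rw [pow_succ' 2 d, pow_mul]; norm_num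
    _ ≤ 2 * 2 ^ d * (2 ^ d).centralBinom := hcb
    _ ≤ 2 * 2 ^ d * ((d + 1).factorial * T.card) := by gcongr
    _ = 2 ^ (d + 1) * (d + 1).factorial * T.card := by ring

open scoped Pointwise in
theorem exists_perm_image_eq {α : Type*} [DecidableEq α] {s t : Finset α}
    (h : s.card = t.card) : ∃ σ : Equiv.Perm α, s.image σ = t := by
  have := Set.powersetCard.isPretransitive (α := α) (n := t.card)
  obtain ⟨σ, hσ⟩ := MulAction.exists_smul_eq (Equiv.Perm α)
    (⟨s, h⟩ : Set.powersetCard α t.card) ⟨t, rfl⟩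
  exact ⟨σ, congrArg Subtype.val hσ⟩

/-- A symmetric GST axiom is determined by the thresholds of a single committee. -/
theorem gstMap_eq_of_eq {m k : ℕ} {τ τ' : Finset (Fin m) → Finset (Finset (Fin m)) → ℕ}
    (hτ : ∀ (σ : Equiv.Perm (Fin m)) W G,
      τ W G = τ (W.image σ) (G.image fun A => A.image σ))
    (hτ' : ∀ (σ : Equiv.Perm (Fin m)) W G,
      τ' W G = τ' (W.image σ) (G.image fun A => A.image σ))
    {W₀ : Finset (Fin m)} (hW₀ : W₀.card = k) (h : τ W₀ = τ' W₀) :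
    gstMap m k τ = gstMap m k τ' := by
  have key : ∀ W : Finset (Fin m), W.card = k → τ W = τ' W := by
    intro W hW
    obtain ⟨σ, hσ⟩ := exists_perm_image_eq (hW.trans hW₀.symm)
    funext G
    rw [hτ σ, hτ' σ, hσ, h]
  funext P
  ext W
  exact and_congr_right fun hW => by rw [key W hW]

theorem two_pow_card_le_of_shatters {m k : ℕ} (hkm : k ≤ m)
    {S : Finset (List (Finset (Fin m)))} (hS : Shatters (SymmGSTFamily m k) S) :
    2 ^ S.card ≤ (k + 2) ^ 2 ^ 2 ^ m := by
  classical
  obtain ⟨f0, f1, hne, hsh⟩ := hS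
  obtain ⟨W₀, -, hW₀⟩ := Finset.exists_subset_card_eq
    (show k ≤ (Finset.univ : Finset (Fin m)).card by simpa using hkm)
  have hsh' (B : S.powerset) : ∃ τ : Finset (Fin m) → Finset (Finset (Fin m)) → ℕ,
      (∀ W G, τ W G ≤ k + 1) ∧
      (∀ (σ : Equiv.Perm (Fin m)) W G,
        τ W G = τ (W.image σ) (G.image fun A => A.image σ)) ∧
      (∀ x ∈ B.1, gstMap m k τ x = f0 x) ∧ ∀ x ∈ S, x ∉ B.1 → gstMap m k τ x = f1 x := by
    obtain ⟨f, ⟨τ, h₁, h₂, rfl⟩, h₃, h₄⟩ := hsh B.1 (Finset.mem_powerset.mp B.2)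
    exact ⟨τ, h₁, h₂, h₃, h₄⟩
  choose τ hle hsymm h0 h1 using hsh'
  let Φ : S.powerset → Finset (Finset (Fin m)) → Fin (k + 2) :=
    fun B G => ⟨τ B W₀ G, Nat.lt_succ_of_le (hle B W₀ G)⟩
  have hsub (B C : S.powerset) (h : Φ B = Φ C) : B.1 ⊆ C.1 := by
    intro x hx
    by_contra hxC
    have hxS := Finset.mem_powerset.mp B.2 hx
    have hτ : τ B W₀ = τ C W₀ := funext fun G => congrArg Fin.val (congrFun h G)
    have heq := congrFun (gstMap_eq_of_eq (hsymm B) (hsymm C) hW₀ hτ) x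
    exact hne x hxS ((h0 B x hx).symm.trans (heq.trans (h1 C x hxS hxC)))
  have hinj : Function.Injective Φ := fun B C h =>
    Subtype.ext ((hsub B C h).antisymm (hsub C B h.symm))
  simpa using Fintype.card_le_of_injective Φ hinj

/-- bounds on the Natarajan dimension of symmetric GST axioms:
`√(2/π)·2^{2^m}/(2^m·m!) ≤ Ndim(ℱ_sGST) ≤ 2^{2^m}·log₂(k+2)`. -/
theorem ndim_symmetric_gst (m k : ℕ) (hm : 2 ≤ m) (hk : 1 ≤ k) (hkm : k ≤ m) :
    (∃ S : Finset (List (Finset (Fin m))), Shatters (SymmGSTFamily m k) S ∧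
      Real.sqrt (2 / Real.pi) * 2 ^ (2 ^ m) / ((2 ^ m : ℝ) * (m.factorial : ℝ))
        ≤ (S.card : ℝ)) ∧
    ∀ S : Finset (List (Finset (Fin m))), Shatters (SymmGSTFamily m k) S →
      (S.card : ℝ) ≤ 2 ^ (2 ^ m) * Real.logb 2 ((k : ℝ) + 2) := by
  refine ⟨?_, fun S hS => ?_⟩
  · obtain ⟨S, hS, hle⟩ := exists_shatters_symmGSTFamily (one_le_two.trans hm) hk hkm
    refine ⟨S, hS, ?_⟩
    have hsqrt : Real.sqrt (2 / Real.pi) ≤ 1 := by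
      rw [Real.sqrt_le_one, div_le_one Real.pi_pos]
      exact Real.two_le_pi
    have hle' : (2 : ℝ) ^ 2 ^ m ≤ 2 ^ m * m.factorial * S.card := by exact_mod_cast hle
    rw [div_le_iff₀ (by positivity), mul_comm (S.card : ℝ)]
    exact (mul_le_of_le_one_left (by positivity) hsqrt).trans hle'
  · have hle : (2 : ℝ) ^ S.card ≤ ((k : ℝ) + 2) ^ 2 ^ 2 ^ m := by
      exact_mod_cast two_pow_card_le_of_shatters hkm hS
    have hlog := Real.logb_le_logb_of_le one_lt_two (by positivity) hle
    rw [Real.logb_pow, Real.logb_pow, Real.logb_self_eq_one one_lt_two, mul_one] at hlog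
    exact_mod_cast hlog
end

section
/- For any GST axiom GST_τ over a finite preference space ℰ, the family ℱ_{≈GST_τ} of its approximate versions satisfies Ndim(ℱ_{≈GST_τ}) ≤ 4·log₂( Σ_{W ∈ C_k} |PD_τ(W)| ) + 4·log₂(8e), provided Σ_{W ∈ C_k} |PD_τ(W)| ≥ 1. Here ℱ_{≈GST_τ} = { f_β : β ≥ 0 }, where for a profile P of n preferences, W ∈ f_β(P) if and only if for every G ⊆ ℰ with τ(W,G) ≤ k, the number of agents in P whose preference lies in G is strictly less than β·τ(W,G)·n/k; and PD_τ(W) = { G ⊆ ℰ : τ(W,G) ≤ k } is the set of potential deviating groups for W. -/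
/-- The `β`-approximate version of the GST axiom with threshold function `τ`:
`W ∈ f_β(P)` iff `W` is a `k`-committee and for every potential deviating group `G`
(i.e. `τ(W,G) ≤ k`), the number of agents with preference in `G` is strictly less
than `β·τ(W,G)·n/k`. -/
def approxGST {E : Type*} [DecidableEq E] (m k : ℕ)
    (τ : Finset (Fin m) → Finset E → ℕ) (β : ℝ) (P : List E) :
    Set (Finset (Fin m)) :=
  {W | W.card = k ∧ ∀ G : Finset E, τ W G ≤ k →
    ((countIn P G : ℝ)) < β * (τ W G : ℝ) * (P.length : ℝ) / (k : ℝ)}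

/-- The approximate versions of a GST axiom grow with `β`. -/
theorem approxGST_mono {E : Type*} [DecidableEq E] (m k : ℕ)
    (τ : Finset (Fin m) → Finset E → ℕ) : Monotone (approxGST m k τ) := by
  intro β γ h P W hW
  refine ⟨hW.1, fun G hG => (hW.2 G hG).trans_le ?_⟩
  gcongr

/-- A family of set-valued functions that is a chain shatters no two distinct points. -/
theorem Shatters.card_le_one_of_isChain {P D : Type*} {F : Set (P → Set D)}
    (hF : IsChain (· ≤ ·) F) {S : Finset P} (hS : Shatters F S) : S.card ≤ 1 := by
  classical
  obtain ⟨f0, f1, hne, h⟩ := hS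
  rw [Finset.card_le_one]
  by_contra! hxy
  obtain ⟨x, hx, y, hy, hxy⟩ := hxy
  have key : ∀ a ∈ S, ∀ b ∈ S, f0 a ≤ f1 a → f1 b ≤ f0 b → False := by
    intro a ha b hb hab hba
    obtain ⟨f, hf, -, hf1⟩ := h ∅ (by simp)
    obtain ⟨g, hg, hg0, -⟩ := h S subset_rfl
    rcases hF.total hf hg with hfg | hgf
    · refine hne a ha (le_antisymm hab ?_)
      rw [← hf1 a ha (by simp), ← hg0 a ha]
      exact hfg a
    · refine hne b hb (le_antisymm ?_ hba)
      rw [← hf1 b hb (by simp), ← hg0 b hb]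
      exact hgf b
  obtain ⟨f, hf, hf0, hf1⟩ := h {x} (by simpa using hx)
  obtain ⟨g, hg, hg0, hg1⟩ := h {y} (by simpa using hy)
  have hfx := hf0 x (by simp)
  have hfy := hf1 y hy (by simpa using hxy.symm)
  have hgy := hg0 y (by simp)
  have hgx := hg1 x hx (by simpa using hxy)
  rcases hF.total hf hg with hfg | hgf
  · exact key x hx y hy (hfx ▸ hgx ▸ hfg x) (hfy ▸ hgy ▸ hfg y)
  · exact key y hy x hx (hgy ▸ hfy ▸ hgf y) (hgx ▸ hfx ▸ hgf x)

/-- the Natarajan dimension of the family of approximate versions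
of a GST axiom is at most `4·log₂(Σ_{W ∈ C_k} |PD_τ(W)|) + 4·log₂(8e)`, provided the
total number of potential deviating groups is at least 1. -/
theorem ndim_approx_gst (E : Type*) [Fintype E] [DecidableEq E] (m k : ℕ)
    (hk : 1 ≤ k) (hkm : k ≤ m)
    (τ : Finset (Fin m) → Finset E → ℕ) (hτ : ∀ W G, τ W G ≤ k + 1)
    (hPD : 1 ≤ ∑ W ∈ Finset.univ.filter (fun W : Finset (Fin m) => W.card = k),
      (Finset.univ.filter fun G : Finset E => τ W G ≤ k).card) :
    ∀ S : Finset (List E),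
      Shatters {f : List E → Set (Finset (Fin m)) |
        ∃ β : ℝ, 0 ≤ β ∧ f = approxGST m k τ β} S →
      (S.card : ℝ) ≤
        4 * Real.logb 2
          ((∑ W ∈ Finset.univ.filter (fun W : Finset (Fin m) => W.card = k),
            (Finset.univ.filter fun G : Finset E => τ W G ≤ k).card : ℕ) : ℝ)
        + 4 * Real.logb 2 (8 * Real.exp 1) := by
  intro S hS
  have hchain : IsChain (· ≤ ·) {f : List E → Set (Finset (Fin m)) |
      ∃ β : ℝ, 0 ≤ β ∧ f = approxGST m k τ β} := by
    rintro _ ⟨β, -, rfl⟩ _ ⟨γ, -, rfl⟩ -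
    exact (le_total β γ).imp (fun h => approxGST_mono m k τ h) fun h => approxGST_mono m k τ h
  have hcard : (S.card : ℝ) ≤ 1 := by exact_mod_cast hS.card_le_one_of_isChain hchain
  have hlog : 0 ≤ Real.logb 2
      ((∑ W ∈ Finset.univ.filter (fun W : Finset (Fin m) => W.card = k),
        (Finset.univ.filter fun G : Finset E => τ W G ≤ k).card : ℕ) : ℝ) :=
    Real.logb_nonneg one_lt_two (by exact_mod_cast hPD)
  have hconst : 1 ≤ Real.logb 2 (8 * Real.exp 1) := by
    rw [Real.le_logb_iff_rpow_le one_lt_two (by positivity), Real.rpow_one]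
    linarith [Real.add_one_le_exp (1 : ℝ)]
  linarith
end
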